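/- arXiv:2401.18030 — 5 statements merged into one kernel-verified Lean document; each statement's English description precedes it below -/
import Mathlib

section
/- There exist δ > 0 and a sequence (π_i)_{i∈ℕ} of stochastic vectors in ℝ^N (entrywise nonnegative, with entries summing to 1) such that π_iᵀ = π_{i+1}ᵀ D_i for all i ∈ ℕ, and every entry of every π_i is at least δ. -/
/-- A backward orbit of a sequence of continuous self-maps of a nonempty compact set. -/
theorem exists_backward_orbit {X : Type*} [TopologicalSpace X] [T2Space X] {C : Set X}
    (hC : IsCompact C) (hne : C.Nonempty) (T : ℕ → X → X) (hT : ∀ i, Continuous (T i))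
    (hmaps : ∀ i, Set.MapsTo (T i) C C) :
    ∃ x : ℕ → X, (∀ i, x i ∈ C) ∧ ∀ i, T i (x (i + 1)) = x i := by
  let K : ℕ → Set (ℕ → X) := fun n =>
    Set.pi Set.univ (fun _ => C) ∩ {x | ∀ i < n, T i (x (i + 1)) = x i}
  have hprod : IsCompact (Set.pi Set.univ (fun _ : ℕ => C)) := isCompact_univ_pi fun _ => hC
  have hclosed (n : ℕ) : IsClosed {x : ℕ → X | ∀ i < n, T i (x (i + 1)) = x i} := by
    simp only [Set.ofPred_forall]
    exact isClosed_iInter fun i => isClosed_iInter fun _ =>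
      isClosed_eq ((hT i).comp (continuous_apply _)) (continuous_apply _)
  have hfinite (n : ℕ) : ∀ T : ℕ → X → X, (∀ i, Set.MapsTo (T i) C C) →
      ∃ x : ℕ → X, (∀ i, x i ∈ C) ∧ ∀ i < n, T i (x (i + 1)) = x i := by
    induction n with
    | zero =>
      obtain ⟨u, hu⟩ := hne
      exact fun _ _ => ⟨fun _ => u, fun _ => hu, by simp⟩
    | succ n ih =>
      intro T hmaps
      obtain ⟨y, hy, hyT⟩ := ih (fun i => T (i + 1)) fun i => hmaps (i + 1)
      refine ⟨fun i => Nat.casesOn i (T 0 (y 0)) y, fun i => ?_, fun i hi => ?_⟩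
      · cases i with
        | zero => exact hmaps 0 (hy 0)
        | succ i => exact hy i
      · cases i with
        | zero => rfl
        | succ i => exact hyT i (by omega)
  obtain ⟨x, hx⟩ := IsCompact.nonempty_iInter_of_sequence_nonempty_isCompact_isClosed K
    (fun n x hx => ⟨hx.1, fun i hi => hx.2 i (by omega)⟩)
    (fun n => by
      obtain ⟨x, hx, hxT⟩ := hfinite n T hmaps
      exact ⟨x, fun i _ => hx i, hxT⟩)
    (hprod.inter_right (hclosed 0))
    (fun n => hprod.isClosed.inter (hclosed n))
  rw [Set.mem_iInter] at hx
  exact ⟨x, fun i => (hx 0).1 i trivial, fun i => (hx (i + 1)).2 i (by omega)⟩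

/-- If some power of `A` is entrywise positive, every proper nonempty set of indices is entered
from outside. -/
theorem exists_apply_ne_zero_of_pow_pos {ι : Type*} [Fintype ι] [DecidableEq ι]
    {A : Matrix ι ι ℝ} {n : ℕ} (hA : ∀ p q, 0 < (A ^ n) p q) {S : Finset ι}
    (hS : S.Nonempty) (hS' : S ≠ Finset.univ) : ∃ p ∉ S, ∃ q ∈ S, A p q ≠ 0 := by
  by_contra! h
  have hpow (m : ℕ) : ∀ p ∉ S, ∀ q ∈ S, (A ^ m) p q = 0 := by
    induction m with
    | zero =>
      intro p hp q hq
      rw [pow_zero, Matrix.one_apply_ne]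
      rintro rfl
      exact hp hq
    | succ m ih =>
      intro p hp q hq
      rw [pow_succ, Matrix.mul_apply]
      refine Finset.sum_eq_zero fun r _ => ?_
      by_cases hr : r ∈ S
      · rw [ih p hp r hr, zero_mul]
      · rw [h r hr q hq, mul_zero]
  obtain ⟨q, hq⟩ := hS
  obtain ⟨p, hp⟩ : ∃ p, p ∉ S := by
    by_contra! hall
    exact hS' (Finset.eq_univ_iff_forall.2 hall)
  exact (hA p q).ne' (hpow n p hp q hq)

/-- Stochastic vectors giving mass at least `ε ^ (N - #S) / N` to each nonempty set `S` of indices,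
where `N` is the number of indices. -/
def massBoundedSimplex (ι : Type*) [Fintype ι] (ε : ℝ) : Set (ι → ℝ) :=
  {v ∈ stdSimplex ℝ ι | ∀ S : Finset ι, S.Nonempty →
    ε ^ (Fintype.card ι - S.card) / Fintype.card ι ≤ ∑ k ∈ S, v k}

theorem isCompact_massBoundedSimplex (ι : Type*) [Fintype ι] (ε : ℝ) :
    IsCompact (massBoundedSimplex ι ε) := by
  refine (isCompact_stdSimplex ℝ ι).inter_right (t := {v : ι → ℝ | ∀ S : Finset ι, S.Nonempty →
    ε ^ (Fintype.card ι - S.card) / Fintype.card ι ≤ ∑ k ∈ S, v k}) ?_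
  simp only [Set.ofPred_forall]
  exact isClosed_iInter fun S => isClosed_iInter fun _ =>
    isClosed_le continuous_const (continuous_finsetSum _ fun k _ => continuous_apply k)

theorem convex_massBoundedSimplex (ι : Type*) [Fintype ι] (ε : ℝ) :
    Convex ℝ (massBoundedSimplex ι ε) := by
  intro v hv w hw a b ha hb hab
  refine ⟨convex_stdSimplex ℝ ι hv.1 hw.1 ha hb hab, fun S hS => ?_⟩
  have hsum : ∑ k ∈ S, (a • v + b • w) k = a * ∑ k ∈ S, v k + b * ∑ k ∈ S, w k := by
    simp [Finset.sum_add_distrib, Finset.mul_sum]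
  have hva := mul_le_mul_of_nonneg_left (hv.2 S hS) ha
  have hwb := mul_le_mul_of_nonneg_left (hw.2 S hS) hb
  rw [hsum]
  calc _ = (a + b) * (ε ^ (Fintype.card ι - S.card) / Fintype.card ι) := by rw [hab, one_mul]
    _ ≤ _ := by linarith

theorem nonempty_massBoundedSimplex (ι : Type*) [Fintype ι] [Nonempty ι] {ε : ℝ} (hε : 0 ≤ ε)
    (hε' : ε ≤ 1) : (massBoundedSimplex ι ε).Nonempty := by
  have hpos : (0 : ℝ) < Fintype.card ι := by exact_mod_cast Fintype.card_pos
  refine ⟨fun _ => 1 / Fintype.card ι, ⟨fun _ => by positivity, ?_⟩, fun S hS => ?_⟩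
  · simp [hpos.ne']
  · have hcard : (1 : ℝ) ≤ S.card := by exact_mod_cast hS.card_pos
    rw [Finset.sum_const, nsmul_eq_mul, mul_one_div]
    gcongr
    exact (pow_le_one₀ hε hε').trans hcard

/-- A stochastic matrix with a positive power, whose diagonal and nonzero entries are at least `ε`,
preserves `massBoundedSimplex`. -/
theorem mapsTo_vecMul_massBoundedSimplex {ι : Type*} [Fintype ι] [DecidableEq ι] [Nonempty ι]
    {ε : ℝ} (hε : 0 ≤ ε) {A : Matrix ι ι ℝ} (hnonneg : ∀ p q, 0 ≤ A p q)
    (hrow : ∀ p, ∑ q, A p q = 1) (hdiag : ∀ p, ε ≤ A p p)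
    (hlow : ∀ p q, A p q ≠ 0 → ε ≤ A p q) {n : ℕ} (hpow : ∀ p q, 0 < (A ^ n) p q) :
    Set.MapsTo (fun v => Matrix.vecMul v A) (massBoundedSimplex ι ε)
      (massBoundedSimplex ι ε) := by
  intro v hv
  have hsum (S : Finset ι) :
      ∑ k ∈ S, Matrix.vecMul v A k = ∑ p, v p * ∑ k ∈ S, A p k := by
    simp only [Matrix.vecMul, dotProduct, Finset.mul_sum]
    exact Finset.sum_comm
  have hstoch : ∑ k, Matrix.vecMul v A k = 1 := by simp [hsum, hrow, hv.1.2]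
  refine ⟨⟨fun k => Finset.sum_nonneg fun p _ => mul_nonneg (hv.1.1 p) (hnonneg p k), hstoch⟩,
    fun S hS => ?_⟩
  by_cases hS' : S = Finset.univ
  · subst hS'
    rw [hstoch, ← hv.1.2]
    exact hv.2 _ hS
  obtain ⟨p, hp, q, hq, hpq⟩ := exists_apply_ne_zero_of_pow_pos hpow hS hS'
  have hlower : ∀ r ∈ insert p S, ε ≤ ∑ k ∈ S, A r k := by
    intro r hr
    rcases Finset.mem_insert.1 hr with rfl | hr
    · exact (hlow r q hpq).trans (Finset.single_le_sum (fun k _ => hnonneg r k) hq)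
    · exact (hdiag r).trans (Finset.single_le_sum (fun k _ => hnonneg r k) hr)
  have hcard : Fintype.card ι - S.card = Fintype.card ι - (insert p S).card + 1 := by
    have := Finset.card_le_univ (insert p S)
    rw [Finset.card_insert_of_notMem hp] at *
    omega
  calc ε ^ (Fintype.card ι - S.card) / Fintype.card ι
      = ε * (ε ^ (Fintype.card ι - (insert p S).card) / Fintype.card ι) := by
        rw [hcard, pow_succ']
        ring
    _ ≤ ε * ∑ r ∈ insert p S, v r :=
        mul_le_mul_of_nonneg_left (hv.2 _ (Finset.insert_nonempty p S)) hε
    _ ≤ ∑ r ∈ insert p S, v r * ∑ k ∈ S, A r k := by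
        rw [Finset.mul_sum]
        refine Finset.sum_le_sum fun r hr => ?_
        rw [mul_comm]
        exact mul_le_mul_of_nonneg_left (hlower r hr) (hv.1.1 r)
    _ ≤ ∑ r, v r * ∑ k ∈ S, A r k :=
        Finset.sum_le_sum_of_subset_of_nonneg (Finset.subset_univ _) fun r _ _ =>
          mul_nonneg (hv.1.1 r) (Finset.sum_nonneg fun k _ => hnonneg r k)
    _ = ∑ k ∈ S, Matrix.vecMul v A k := (hsum S).symm


/-- Existence of a uniformly-positive absolute probability sequence `(π_i)` for the chain
`D_i = (1−β_i) I + β_i A_i`. -/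
theorem stmt5 (N : ℕ) (hN : 1 ≤ N) (ε : ℝ) (hε : 0 < ε)
    (A : ℕ → Matrix (Fin N) (Fin N) ℝ)
    (hnonneg : ∀ i p q, 0 ≤ A i p q) (hrow : ∀ i p, ∑ q, A i p q = 1)
    (hdiag : ∀ i p, ε ≤ A i p p) (hlow : ∀ i p q, A i p q ≠ 0 → ε ≤ A i p q)
    (hprim : ∀ i, ∃ n : ℕ, 1 ≤ n ∧ ∀ p q, 0 < (A i ^ n) p q)
    (β : ℕ → ℝ) (hβ : ∀ i, 0 < β i ∧ β i < 1)
    (D : ℕ → Matrix (Fin N) (Fin N) ℝ)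
    (hD : ∀ i, D i = (1 - β i) • (1 : Matrix (Fin N) (Fin N) ℝ) + β i • A i) :
    ∃ δ : ℝ, 0 < δ ∧ ∃ π : ℕ → Fin N → ℝ,
      (∀ i k, 0 ≤ π i k) ∧ (∀ i, ∑ k, π i k = 1) ∧
      (∀ i, Matrix.vecMul (π (i + 1)) (D i) = π i) ∧
      (∀ i k, δ ≤ π i k) := by
  have : Nonempty (Fin N) := ⟨⟨0, hN⟩⟩
  have hε' : ε ≤ 1 := by
    let p : Fin N := ⟨0, hN⟩
    rw [← hrow 0 p]
    exact (hdiag 0 p).trans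
      (Finset.single_le_sum (fun q _ => hnonneg 0 p q) (Finset.mem_univ p))
  have hmaps (i : ℕ) : Set.MapsTo (fun v => Matrix.vecMul v (D i))
      (massBoundedSimplex (Fin N) ε) (massBoundedSimplex (Fin N) ε) := by
    intro v hv
    obtain ⟨n, -, hn⟩ := hprim i
    have hvA := mapsTo_vecMul_massBoundedSimplex hε.le (hnonneg i) (hrow i) (hdiag i) (hlow i)
      hn hv
    have hconv := convex_massBoundedSimplex (Fin N) ε hv hvA (sub_nonneg.2 (hβ i).2.le)
      (hβ i).1.le (sub_add_cancel 1 (β i))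
    simpa only [hD i, Matrix.vecMul_add, Matrix.vecMul_smul, Matrix.vecMul_one] using hconv
  obtain ⟨π, hπ, hπD⟩ := exists_backward_orbit (isCompact_massBoundedSimplex (Fin N) ε)
    (nonempty_massBoundedSimplex (Fin N) hε.le hε') (fun i v => Matrix.vecMul v (D i))
    (fun i => by fun_prop) hmaps
  refine ⟨ε ^ (N - 1) / N, by positivity, π, fun i => (hπ i).1.1, fun i => (hπ i).1.2, hπD,
    fun i k => ?_⟩
  simpa using (hπ i).2 {k} (Finset.singleton_nonempty k)
end

section
/- Let Θ : ℝ^M → ℝ be convex and nonnegative, let x, y ∈ ℝ^M with Θ(y) = 0, let g be a subgradient of Θ at x with g ≠ 0, let μ ∈ (0,2), and set Φ := (μ Θ(x)/‖g‖²) g. Then ‖Φ‖² − 2⟨x − y, Φ⟩ ≤ −μ(2−μ) Θ(x)²/‖g‖². -/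
open scoped RealInnerProductSpace

/-- Key inequality for the (superiorized) APSM subgradient step. -/
theorem stmt9 (M : ℕ) (Θ : EuclideanSpace ℝ (Fin M) → ℝ)
    (hconv : ConvexOn ℝ Set.univ Θ) (hnonneg : ∀ x, 0 ≤ Θ x)
    (x y : EuclideanSpace ℝ (Fin M)) (hy : Θ y = 0)
    (g : EuclideanSpace ℝ (Fin M))
    (hg : ∀ u : EuclideanSpace ℝ (Fin M), ⟪u - x, g⟫ + Θ x ≤ Θ u) (hg0 : g ≠ 0)
    (μ : ℝ) (hμ : 0 < μ ∧ μ < 2)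
    (Φ : EuclideanSpace ℝ (Fin M)) (hΦ : Φ = (μ * Θ x / ‖g‖ ^ 2) • g) :
    ‖Φ‖ ^ 2 - 2 * ⟪x - y, Φ⟫ ≤ -(μ * (2 - μ) * (Θ x) ^ 2 / ‖g‖ ^ 2) := by
  have hg_sq : 0 < ‖g‖ ^ 2 := by positivity
  have hinner : Θ x ≤ ⟪x - y, g⟫ := by
    have h := hg y
    rw [← neg_sub x y, inner_neg_left] at h
    linarith
  have hcoef : 0 ≤ μ * Θ x / ‖g‖ ^ 2 :=
    div_nonneg (mul_nonneg hμ.1.le (hnonneg x)) hg_sq.le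
  rw [hΦ, norm_smul, inner_smul_right, mul_pow, Real.norm_eq_abs, sq_abs]
  calc (μ * Θ x / ‖g‖ ^ 2) ^ 2 * ‖g‖ ^ 2 - 2 * (μ * Θ x / ‖g‖ ^ 2 * ⟪x - y, g⟫)
      ≤ (μ * Θ x / ‖g‖ ^ 2) ^ 2 * ‖g‖ ^ 2 - 2 * (μ * Θ x / ‖g‖ ^ 2 * Θ x) := by gcongr
    _ = -(μ * (2 - μ) * (Θ x) ^ 2 / ‖g‖ ^ 2) := by
      field_simp
      ring
end

section
/- Let X ⊂ ℝ^M be a nonempty closed convex set with metric projection P_X, let Θ : ℝ^M → ℝ be convex and nonnegative, let x ∈ ℝ^M and y ∈ X with Θ(y) = 0, let g be a subgradient of Θ at x with g ≠ 0, let μ ∈ (0,2), set Φ := (μ Θ(x)/‖g‖²) g, and let z ∈ ℝ^M and ζ ≥ 0. Then ‖P_X(x − Φ + ζ z) − y‖² ≤ ‖x − y‖² − μ(2−μ) Θ(x)²/‖g‖² + ζ²‖z‖² + 2ζ ⟨z, x − Φ − y⟩. -/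
open scoped RealInnerProductSpace

/-- A nearest point `p` of a convex set to `v` is at least as close as `v` to every point of the
set. -/
theorem norm_sub_le_of_nearest_point {F : Type*} [NormedAddCommGroup F] [InnerProductSpace ℝ F]
    {K : Set F} (hK : Convex ℝ K) {v p y : F} (hp : p ∈ K)
    (hmin : ∀ w ∈ K, ‖v - p‖ ≤ ‖v - w‖) (hy : y ∈ K) : ‖p - y‖ ≤ ‖v - y‖ := by
  have : Nonempty K := ⟨⟨p, hp⟩⟩
  have hinf : ‖v - p‖ = ⨅ w : K, ‖v - w‖ :=
    le_antisymm (le_ciInf fun w => hmin w w.2)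
      (ciInf_le ⟨0, Set.forall_mem_range.2 fun w : K => norm_nonneg (v - w)⟩ (⟨p, hp⟩ : K))
  have hobtuse := (norm_eq_iInf_iff_real_inner_le_zero hK hp).1 hinf y hy
  have hexpand := norm_sub_sq_real (v - p) (y - p)
  rw [sub_sub_sub_cancel_right, norm_sub_rev y p] at hexpand
  refine (sq_le_sq₀ (norm_nonneg _) (norm_nonneg _)).1 ?_
  nlinarith [sq_nonneg ‖v - p‖]

/-- A relaxed subgradient projection step decreases the squared distance to any zero of the
objective, given the subgradient inequality `t ≤ ⟪x - y, g⟫`. -/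
theorem norm_sub_relaxed_step_sq_le {F : Type*} [NormedAddCommGroup F] [InnerProductSpace ℝ F]
    {x y g : F} (hg : g ≠ 0) {t μ : ℝ} (ht : 0 ≤ t) (hμ : 0 ≤ μ) (h : t ≤ ⟪x - y, g⟫) :
    ‖x - (μ * t / ‖g‖ ^ 2) • g - y‖ ^ 2
      ≤ ‖x - y‖ ^ 2 - μ * (2 - μ) * t ^ 2 / ‖g‖ ^ 2 := by
  have hn : ‖g‖ ≠ 0 := norm_ne_zero_iff.2 hg
  have hc : 0 ≤ μ * t / ‖g‖ ^ 2 := by positivity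
  have hmul := mul_le_mul_of_nonneg_left h hc
  have hid : -2 * (μ * t / ‖g‖ ^ 2 * t) + (μ * t / ‖g‖ ^ 2) ^ 2 * ‖g‖ ^ 2
      = -(μ * (2 - μ) * t ^ 2 / ‖g‖ ^ 2) := by
    field_simp
    ring
  rw [sub_right_comm, norm_sub_sq_real, inner_smul_right, norm_smul, mul_pow, Real.norm_eq_abs,
    sq_abs]
  linarith

/-- One-step inequality for the projected, superiorized APSM update. -/
theorem stmt10 (M : ℕ) (X : Set (EuclideanSpace ℝ (Fin M))) (hXne : X.Nonempty)
    (hXcl : IsClosed X) (hXconv : Convex ℝ X)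
    (PX : EuclideanSpace ℝ (Fin M) → EuclideanSpace ℝ (Fin M))
    (hPX : ∀ v, PX v ∈ X ∧ ∀ x ∈ X, ‖v - PX v‖ ≤ ‖v - x‖)
    (Θ : EuclideanSpace ℝ (Fin M) → ℝ)
    (hconv : ConvexOn ℝ Set.univ Θ) (hnonneg : ∀ x, 0 ≤ Θ x)
    (x y : EuclideanSpace ℝ (Fin M)) (hyX : y ∈ X) (hy : Θ y = 0)
    (g : EuclideanSpace ℝ (Fin M))
    (hg : ∀ u : EuclideanSpace ℝ (Fin M), ⟪u - x, g⟫ + Θ x ≤ Θ u) (hg0 : g ≠ 0)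
    (μ : ℝ) (hμ : 0 < μ ∧ μ < 2)
    (Φ : EuclideanSpace ℝ (Fin M)) (hΦ : Φ = (μ * Θ x / ‖g‖ ^ 2) • g)
    (z : EuclideanSpace ℝ (Fin M)) (ζ : ℝ) (hζ : 0 ≤ ζ) :
    ‖PX (x - Φ + ζ • z) - y‖ ^ 2
      ≤ ‖x - y‖ ^ 2 - μ * (2 - μ) * (Θ x) ^ 2 / ‖g‖ ^ 2
        + ζ ^ 2 * ‖z‖ ^ 2 + 2 * ζ * ⟪z, x - Φ - y⟫ := by
  have hsub : Θ x ≤ ⟪x - y, g⟫ := by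
    have h := hg y
    rw [hy, ← neg_sub x y, inner_neg_left] at h
    linarith
  have hstep := norm_sub_relaxed_step_sq_le hg0 (hnonneg x) hμ.1.le hsub
  rw [← hΦ] at hstep
  obtain ⟨hmem, hmin⟩ := hPX (x - Φ + ζ • z)
  have hproj := pow_le_pow_left₀ (norm_nonneg _)
    (norm_sub_le_of_nearest_point hXconv hmem hmin hyX) 2
  rw [add_sub_right_comm (x - Φ) (ζ • z) y, norm_add_sq_real, inner_smul_right, norm_smul, mul_pow,
    Real.norm_eq_abs, sq_abs, real_inner_comm] at hproj
  linarith
end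

section
/- Let (x_i)_{i∈ℕ} be a sequence in ℝ^M, let q ∈ ℝ^M, and let (ε_i)_{i∈ℕ} be a summable sequence of nonnegative reals such that ‖x_{i+1} − q‖² ≤ ‖x_i − q‖² + ε_i for all i ∈ ℕ. Then the sequence (‖x_i − q‖)_{i∈ℕ} converges to a finite limit, and the sequence (x_i)_{i∈ℕ} is bounded. -/
open Filter

/-- A nonnegative real sequence whose increments are bounded above by a summable nonnegative
sequence converges. -/
theorem exists_tendsto_of_le_add_summable {a ε : ℕ → ℝ} (ha : ∀ i, 0 ≤ a i)
    (hε : ∀ i, 0 ≤ ε i) (hsum : Summable ε) (h : ∀ i, a (i + 1) ≤ a i + ε i) :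
    ∃ l : ℝ, Tendsto a atTop (nhds l) := by
  have hanti : Antitone fun n => a n - ∑ i ∈ Finset.range n, ε i := by
    refine antitone_nat_of_succ_le fun n => ?_
    rw [Finset.sum_range_succ]
    linarith [h n]
  have hbdd : BddBelow (Set.range fun n => a n - ∑ i ∈ Finset.range n, ε i) := by
    refine ⟨-∑' i, ε i, ?_⟩
    rintro _ ⟨n, rfl⟩
    have := hsum.sum_le_tsum (Finset.range n) fun i _ => hε i
    dsimp only
    linarith [ha n]
  have hlim := (tendsto_atTop_ciInf hanti hbdd).add hsum.hasSum.tendsto_sum_nat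
  simp only [sub_add_cancel] at hlim
  exact ⟨_, hlim⟩

/-- A quasi-Fejér monotone (type III) sequence with respect to a point `q`: the distances to `q`
converge to a finite limit and the sequence is bounded. -/
theorem stmt11 (M : ℕ) (x : ℕ → EuclideanSpace ℝ (Fin M)) (q : EuclideanSpace ℝ (Fin M))
    (ε : ℕ → ℝ) (hε : ∀ i, 0 ≤ ε i) (hsum : Summable ε)
    (h : ∀ i, ‖x (i + 1) - q‖ ^ 2 ≤ ‖x i - q‖ ^ 2 + ε i) :
    (∃ L : ℝ, Tendsto (fun i => ‖x i - q‖) atTop (nhds L)) ∧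
      Bornology.IsBounded (Set.range x) := by
  obtain ⟨l, hl⟩ := exists_tendsto_of_le_add_summable (fun i => sq_nonneg ‖x i - q‖) hε hsum h
  have hlim : Tendsto (fun i => ‖x i - q‖) atTop (nhds (√l)) := by
    simpa only [Real.sqrt_sq (norm_nonneg _)] using hl.sqrt
  refine ⟨⟨_, hlim⟩, ?_⟩
  obtain ⟨C, hC⟩ := hlim.bddAbove_range
  refine Metric.isBounded_closedBall.subset (s := Set.range x) (t := Metric.closedBall q C) ?_
  rintro _ ⟨i, rfl⟩
  rw [mem_closedBall_iff_norm]
  exact hC ⟨i, rfl⟩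
end

section
/- Let (x_i)_{i∈ℕ} be a sequence in ℝ^M and Q ⊂ ℝ^M a set such that for every q ∈ Q the limit lim_{i→∞} ‖x_i − q‖ exists and is finite. If Q contains a closed Euclidean ball of some radius ρ > 0 (i.e., Q has nonempty interior), then the sequence (x_i)_{i∈ℕ} converges to a point of ℝ^M. -/
open Filter

/-- If the distances from `x i` to `u` and to `u + v` both converge, then so do the inner
products of `x i` with `v`. -/
theorem exists_tendsto_inner_of_tendsto_norm_sub {ι E : Type*} [NormedAddCommGroup E]
    [InnerProductSpace ℝ E] {l : Filter ι} {x : ι → E} {u v : E} {a b : ℝ}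
    (ha : Tendsto (fun i => ‖x i - u‖) l (nhds a))
    (hb : Tendsto (fun i => ‖x i - (u + v)‖) l (nhds b)) :
    ∃ c : ℝ, Tendsto (fun i => inner ℝ (x i) v) l (nhds c) := by
  refine ⟨(a ^ 2 - b ^ 2 + ‖v‖ ^ 2) / 2 + inner ℝ u v, ?_⟩
  refine (((((ha.pow 2).sub (hb.pow 2)).add_const (‖v‖ ^ 2)).div_const 2).add_const
    (inner ℝ u v)).congr fun i => ?_
  rw [← sub_sub, norm_sub_sq_real (x i - u) v, inner_sub_left]
  ring

/-- If for every `q` in a set `Q` with nonempty interior (containing a closed ball of positive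
radius) the limit `lim ‖x_i − q‖` exists, then the sequence `(x_i)` converges. -/
theorem stmt12 (M : ℕ) (x : ℕ → EuclideanSpace ℝ (Fin M)) (Q : Set (EuclideanSpace ℝ (Fin M)))
    (h : ∀ q ∈ Q, ∃ L : ℝ, Tendsto (fun i => ‖x i - q‖) atTop (nhds L))
    (hball : ∃ u : EuclideanSpace ℝ (Fin M), ∃ ρ : ℝ, 0 < ρ ∧ Metric.closedBall u ρ ⊆ Q) :
    ∃ p : EuclideanSpace ℝ (Fin M), Tendsto x atTop (nhds p) := by
  obtain ⟨u, ρ, hρ, hQ⟩ := hball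
  obtain ⟨a, ha⟩ := h u (hQ (Metric.mem_closedBall_self hρ.le))
  have hcoord (j : Fin M) : ∃ c : ℝ, Tendsto (fun i => x i j) atTop (nhds c) := by
    obtain ⟨b, hb⟩ := h (u + EuclideanSpace.single j ρ) <| hQ <| by
      simp [Metric.mem_closedBall, dist_eq_norm, abs_of_pos hρ]
    obtain ⟨c, hc⟩ := exists_tendsto_inner_of_tendsto_norm_sub ha hb
    refine ⟨c / ρ, (hc.div_const ρ).congr fun i => ?_⟩
    simp [EuclideanSpace.inner_single_right, hρ.ne']
  choose c hc using hcoord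
  exact ⟨WithLp.toLp 2 c, ((PiLp.continuous_toLp 2 _).tendsto c).comp (tendsto_pi_nhds.2 hc)⟩
end
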